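/- arXiv:2003.02993 — 2 statements merged into one kernel-verified Lean document; each statement's English description precedes it below -/
import Mathlib

section
/- Let d ≥ 1 be an integer and 1 ≤ p < ∞. Let ω be a submultiplicative weight on ℝ^d and ν an ω-moderate weight with constant C₀ > 0. Let Λ ⊆ ℝ^d be countable and (φ_λ)_{λ∈Λ} measurable functions ℝ^d → ℝ with D := sup_{x∈ℝ^d} Σ_{λ∈Λ} |φ_λ(x)| ω(x−λ) < ∞. Suppose f : ℝ^d → ℝ satisfies f(x) = Σ_{λ∈Λ} c(λ)φ_λ(x) for every x ∈ ℝ^d (the series converging absolutely), where c : Λ → ℝ satisfies ‖c‖_{ℓ^p_ν(Λ)} ≤ B_p ‖f‖_{L^p_ν(ℝ^d)} for some constant B_p > 0. Then ‖f‖_{L^∞_ν(ℝ^d)} ≤ C₀ D B_p ‖f‖_{L^p_ν(ℝ^d)}. -/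
open MeasureTheory

/-- Each coordinate of a `p`-summable family is bounded by its `ℓ^p` norm. -/
theorem abs_le_tsum_rpow {ι : Type*} {a : ι → ℝ} {p : ℝ} (hp : 1 ≤ p)
    (ha : Summable fun i => |a i| ^ p) (i : ι) :
    |a i| ≤ (∑' j, |a j| ^ p) ^ (1 / p) := by
  have hp0 : p ≠ 0 := by positivity
  calc |a i| = (|a i| ^ p) ^ (1 / p) := by
        rw [one_div, Real.rpow_rpow_inv (abs_nonneg _) hp0]
    _ ≤ (∑' j, |a j| ^ p) ^ (1 / p) := by
        refine Real.rpow_le_rpow (by positivity) ?_ (by positivity)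
        exact ha.le_tsum i fun j _ => by positivity

/-- `‖f‖_{L^∞_ν} ≤ C₀ D B_p ‖f‖_{L^p_ν}` for `f = ∑ c(λ) φ_λ` with
`‖c‖_{ℓ^p_ν} ≤ B_p ‖f‖_{L^p_ν}`. -/
theorem statement1
    (d : ℕ) (hd : 1 ≤ d)
    (p : ℝ) (hp : 1 ≤ p)
    (ω ν : (Fin d → ℝ) → ℝ)
    (hω_cont : Continuous ω) (hω_pos : ∀ x, 0 < ω x)
    (hω_even : ∀ x, ω (-x) = ω x)
    (hω_sub : ∀ x y, ω (x + y) ≤ ω x * ω y)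
    (C₀ : ℝ) (hC₀ : 0 < C₀)
    (hν_cont : Continuous ν) (hν_pos : ∀ x, 0 < ν x)
    (hν_even : ∀ x, ν (-x) = ν x)
    (hν_mod : ∀ x y, ν (x + y) ≤ C₀ * ω x * ν y)
    (Λ : Set (Fin d → ℝ)) (hΛ : Λ.Countable)
    (φ : Λ → (Fin d → ℝ) → ℝ) (hφ : ∀ l, Measurable (φ l))
    (D : ℝ)
    (hDsum : ∀ x, Summable fun l : Λ => |φ l x| * ω (x - (l : Fin d → ℝ)))
    (hD : ∀ x, (∑' l : Λ, |φ l x| * ω (x - (l : Fin d → ℝ))) ≤ D)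
    (f : (Fin d → ℝ) → ℝ) (c : Λ → ℝ)
    (Bp : ℝ) (hBp : 0 < Bp)
    (hf : ∀ x, HasSum (fun l : Λ => c l * φ l x) (f x))
    (hfint : Integrable fun x => |f x * ν x| ^ p)
    (hc : Summable fun l : Λ => |c l * ν (l : Fin d → ℝ)| ^ p)
    (hcB : (∑' l : Λ, |c l * ν (l : Fin d → ℝ)| ^ p) ^ (1 / p)
            ≤ Bp * (∫ x, |f x * ν x| ^ p) ^ (1 / p)) :
    ∀ x, |f x * ν x| ≤ C₀ * D * Bp * (∫ x, |f x * ν x| ^ p) ^ (1 / p) := by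
  intro x
  set M := (∑' l : Λ, |c l * ν (l : Fin d → ℝ)| ^ p) ^ (1 / p)
  have hcM : ∀ l : Λ, |c l| * ν l ≤ M := fun l => by
    rw [← abs_of_pos (hν_pos l), ← abs_mul]
    exact abs_le_tsum_rpow hp hc l
  have hM : 0 ≤ M := Real.rpow_nonneg (tsum_nonneg fun l => by positivity) _
  have hD0 : 0 ≤ D :=
    (tsum_nonneg fun l : Λ => mul_nonneg (abs_nonneg (φ l x)) (hω_pos _).le).trans (hD x)
  have hterm : ∀ l : Λ, ‖c l * φ l x * ν x‖ ≤ C₀ * M * (|φ l x| * ω (x - l)) := fun l => by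
    have hν : ν x ≤ C₀ * ω (x - l) * ν l := by simpa using hν_mod (x - l) l
    have hω := hω_pos (x - l)
    calc ‖c l * φ l x * ν x‖ = |c l| * |φ l x| * ν x := by
          rw [Real.norm_eq_abs, abs_mul, abs_mul, abs_of_pos (hν_pos x)]
      _ ≤ |c l| * |φ l x| * (C₀ * ω (x - l) * ν l) := by gcongr
      _ = C₀ * (|c l| * ν l) * (|φ l x| * ω (x - l)) := by ring
      _ ≤ C₀ * M * (|φ l x| * ω (x - l)) := by gcongr; exact hcM l
  calc |f x * ν x| ≤ C₀ * M * ∑' l : Λ, |φ l x| * ω (x - l) :=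
        ((hf x).mul_right (ν x)).norm_le_of_bounded ((hDsum x).hasSum.mul_left (C₀ * M)) hterm
    _ ≤ C₀ * M * D := by gcongr; exact hD x
    _ ≤ C₀ * (Bp * (∫ x, |f x * ν x| ^ p) ^ (1 / p)) * D := by gcongr
    _ = C₀ * D * Bp * (∫ x, |f x * ν x| ^ p) ^ (1 / p) := by ring
end

section
/- Let d ≥ 1 be an integer, 1 ≤ p < ∞, ν : ℝ^d → (0,∞) continuous, and ρ a probability density on ℝ^d with C_ρ := ess sup_{x∈ℝ^d} ρ(x) < ∞. Let x_j be an ℝ^d-valued random variable with law ρ(x)dx. Let f, g : ℝ^d → ℝ be measurable with finite ‖·‖_{L^∞_ν(ℝ^d)} and ‖·‖_{L^p_ν(ℝ^d)} norms, and for h ∈ {f, g} set X_j(h) = |h(x_j)ν(x_j)|^p − ∫_{ℝ^d} ρ(y)|h(y)ν(y)|^p dy. Then Var( X_j(f) − X_j(g) ) ≤ p C_ρ · ( max{ ‖f‖_{L^∞_ν(ℝ^d)}, ‖g‖_{L^∞_ν(ℝ^d)} } )^{p−1} · ‖f − g‖_{L^∞_ν(ℝ^d)} · ( ‖f‖_{L^p_ν(ℝ^d)}^p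 + ‖g‖_{L^p_ν(ℝ^d)}^p ). -/
open MeasureTheory ProbabilityTheory

/-- The map `t ↦ t ^ p` is Lipschitz on `[0, M]` with constant `p * M ^ (p - 1)`. -/
theorem abs_rpow_sub_rpow_le {p M u v : ℝ} (hp : 1 ≤ p) (hu : u ∈ Set.Icc 0 M)
    (hv : v ∈ Set.Icc 0 M) : |u ^ p - v ^ p| ≤ p * M ^ (p - 1) * |u - v| := by
  have h := (convex_Icc (0 : ℝ) M).norm_image_sub_le_of_norm_hasDerivWithin_le
    (f := fun t : ℝ => t ^ p) (f' := fun t : ℝ => p * t ^ (p - 1)) (C := p * M ^ (p - 1))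
    (fun t _ => (Real.hasDerivAt_rpow_const (Or.inr hp)).hasDerivWithinAt)
    (fun t ht => by
      have ht0 : 0 ≤ t := ht.1
      rw [Real.norm_of_nonneg (by positivity)]
      have := Real.rpow_le_rpow ht0 ht.2 (sub_nonneg.2 hp)
      gcongr) hv hu
  simpa [Real.norm_eq_abs] using h

/-- The second moment of a function of a random variable whose law has density `ρ ≤ C`. -/
theorem integral_sq_comp_le_of_density_le {E Ω : Type*} [MeasurableSpace E] [MeasurableSpace Ω]
    {μ : Measure E} {P : Measure Ω} {ρ : E → ℝ} (hρ_meas : Measurable ρ) (hρ_nonneg : ∀ x, 0 ≤ ρ x)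
    {C : ℝ} (hC : ∀ᵐ x ∂μ, ρ x ≤ C) {X : Ω → E} (hX : Measurable X)
    (hlaw : Measure.map X P = μ.withDensity fun t => ENNReal.ofReal (ρ t))
    {φ ψ : E → ℝ} (hφ : Measurable φ) (hψ : Integrable ψ μ) (hφψ : ∀ x, φ x ^ 2 ≤ ψ x) :
    (∫ ω, φ (X ω) ^ 2 ∂P) ≤ C * ∫ x, ψ x ∂μ := by
  rw [← integral_map (f := fun x => φ x ^ 2) hX.aemeasurable
      (hφ.pow_const 2).aestronglyMeasurable, hlaw,
    integral_withDensity_eq_integral_toReal_smul hρ_meas.ennreal_ofReal (by simp),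
    ← integral_const_mul]
  refine integral_mono_of_nonneg (Filter.Eventually.of_forall fun x => ?_) (hψ.const_mul C) ?_
  · simp only [Pi.zero_apply, smul_eq_mul]
    positivity
  · filter_upwards [hC] with x hx
    simp only [smul_eq_mul, ENNReal.toReal_ofReal (hρ_nonneg x)]
    exact mul_le_mul hx (hφψ x) (sq_nonneg _) ((hρ_nonneg x).trans hx)

/-- variance bound for the difference
`Var(X_j(f) − X_j(g)) ≤ p C_ρ (max{‖f‖_∞,ν, ‖g‖_∞,ν})^{p−1} ‖f−g‖_∞,ν (‖f‖_{p,ν}^p + ‖g‖_{p,ν}^p)`. -/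
theorem statement8
    (d : ℕ) (hd : 1 ≤ d)
    (p : ℝ) (hp : 1 ≤ p)
    (ν : (Fin d → ℝ) → ℝ) (hν_cont : Continuous ν) (hν_pos : ∀ x, 0 < ν x)
    (ρ : (Fin d → ℝ) → ℝ) (hρ_meas : Measurable ρ) (hρ_nonneg : ∀ x, 0 ≤ ρ x)
    (hρ_int : Integrable ρ) (hρ_one : (∫ x, ρ x) = 1)
    (Cρ : ℝ) (hCρ : ∀ᵐ x ∂(volume : Measure (Fin d → ℝ)), ρ x ≤ Cρ)
    (Ω : Type*) [MeasurableSpace Ω] (P : Measure Ω) [IsProbabilityMeasure P]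
    (xj : Ω → (Fin d → ℝ)) (hxj : Measurable xj)
    (hlaw : Measure.map xj P = volume.withDensity fun t => ENNReal.ofReal (ρ t))
    (f g : (Fin d → ℝ) → ℝ) (hf_meas : Measurable f) (hg_meas : Measurable g)
    (hf_bdd : BddAbove (Set.range fun x => |f x * ν x|))
    (hg_bdd : BddAbove (Set.range fun x => |g x * ν x|))
    (hf_int : Integrable fun x => |f x * ν x| ^ p)
    (hg_int : Integrable fun x => |g x * ν x| ^ p) :
    variance (fun ω =>
        (|f (xj ω) * ν (xj ω)| ^ p - ∫ y, ρ y * |f y * ν y| ^ p)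
          - (|g (xj ω) * ν (xj ω)| ^ p - ∫ y, ρ y * |g y * ν y| ^ p)) P
      ≤ p * Cρ * (max (⨆ x, |f x * ν x|) (⨆ x, |g x * ν x|)) ^ (p - 1)
          * (⨆ x, |(f x - g x) * ν x|)
          * ((∫ x, |f x * ν x| ^ p) + ∫ x, |g x * ν x| ^ p) := by
  set M := max (⨆ x, |f x * ν x|) (⨆ x, |g x * ν x|)
  set D := ⨆ x, |(f x - g x) * ν x|
  have hfM : ∀ x, |f x * ν x| ≤ M := fun x => (le_ciSup hf_bdd x).trans (le_max_left _ _)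
  have hgM : ∀ x, |g x * ν x| ≤ M := fun x => (le_ciSup hg_bdd x).trans (le_max_right _ _)
  have hfgD : ∀ x, |(f x - g x) * ν x| ≤ D := by
    refine le_ciSup (f := fun x => |(f x - g x) * ν x|) ⟨M + M, ?_⟩
    rintro _ ⟨x, rfl⟩
    simp only [sub_mul]
    exact (abs_sub _ _).trans (add_le_add (hfM x) (hgM x))
  have hM0 : 0 ≤ M := (abs_nonneg _).trans (hfM 0)
  have hν := hν_cont.measurable
  have hφ : Measurable fun x => |f x * ν x| ^ p - |g x * ν x| ^ p :=
    ((hf_meas.mul hν).abs.pow_const p).sub ((hg_meas.mul hν).abs.pow_const p)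
  have hφψ : ∀ x, (|f x * ν x| ^ p - |g x * ν x| ^ p) ^ 2
      ≤ p * M ^ (p - 1) * D * (|f x * ν x| ^ p + |g x * ν x| ^ p) := by
    intro x
    have hsum : |(|f x * ν x| ^ p - |g x * ν x| ^ p)| ≤ |f x * ν x| ^ p + |g x * ν x| ^ p := by
      have ha : 0 ≤ |f x * ν x| ^ p := by positivity
      have hb : 0 ≤ |g x * ν x| ^ p := by positivity
      exact abs_le.2 ⟨by linarith, by linarith⟩
    have hdiff : |(|f x * ν x| ^ p - |g x * ν x| ^ p)| ≤ p * M ^ (p - 1) * D := by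
      refine (abs_rpow_sub_rpow_le hp ⟨abs_nonneg _, hfM x⟩ ⟨abs_nonneg _, hgM x⟩).trans ?_
      gcongr
      refine (abs_abs_sub_abs_le_abs_sub _ _).trans ?_
      rw [← sub_mul]
      exact hfgD x
    rw [← sq_abs, sq]
    exact mul_le_mul hdiff hsum (abs_nonneg _) ((abs_nonneg _).trans hdiff)
  have hcomp : Measurable fun ω =>
      |f (xj ω) * ν (xj ω)| ^ p - |g (xj ω) * ν (xj ω)| ^ p := hφ.comp hxj
  simp only [sub_sub_sub_comm (_ ^ p)]
  rw [variance_sub_const hcomp.aestronglyMeasurable]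
  refine (variance_le_expectation_sq hcomp.aestronglyMeasurable).trans ?_
  refine (integral_sq_comp_le_of_density_le hρ_meas hρ_nonneg hCρ hxj hlaw hφ
    ((hf_int.add hg_int).const_mul (p * M ^ (p - 1) * D)) hφψ).trans_eq ?_
  simp only [Pi.add_apply]
  rw [integral_const_mul, integral_add hf_int hg_int]
  ring
end
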